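/- arXiv:1011.5599 — 6 statements merged into one kernel-verified Lean document; each statement's English description precedes it below -/
import Mathlib

section
/- Let (Ω, 𝔽, P) be a probability space, T a nonempty finite set with a designated element D ∈ T, and 0 < ε < 1, δ ≥ 0. Let N : T → ℝ be positive with N(t) ≤ N(D) for all t ∈ T, and for each t ∈ T let N̂(t) be a positive measurable real random variable such that N̂(ω)(t) ≤ N̂(ω)(D) for all t ∈ T and all ω ∈ Ω, and such that P(|N̂(t)/N(t) − 1| ≤ ε) ≥ 1 − δ. Define H(t) = N(t)/N(D) and Ĥ(t) = N̂(t)/N̂(D). Then for any points t₀, …, t_{k−1} ∈ T, with probability at least 1 − (k+1)·δ it holds simultaneously for all i < k that (1 − 2ε)·H(tᵢ) ≤ Ĥ(tᵢ) ≤ (1 + 2ε/(1−ε))·H(tᵢ). -/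
open MeasureTheory ProbabilityTheory

/-- Union bound: finitely many events of probability at least `1 - δ` hold simultaneously with
probability at least `1 - n * δ`, where `n` is their number. -/
theorem one_sub_card_mul_le_measureReal_iInter {Ω ι : Type*} [MeasurableSpace Ω]
    (μ : Measure Ω) [IsProbabilityMeasure μ] [Fintype ι] {E : ι → Set Ω} {δ : ℝ}
    (hE : ∀ i, MeasurableSet (E i)) (hδ : ∀ i, 1 - δ ≤ μ.real (E i)) :
    1 - Fintype.card ι * δ ≤ μ.real (⋂ i, E i) := by
  have hcompl : μ.real (⋂ i, E i)ᶜ ≤ Fintype.card ι * δ := by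
    rw [Set.compl_iInter]
    calc μ.real (⋃ i, (E i)ᶜ) ≤ ∑ i, μ.real (E i)ᶜ := measureReal_iUnion_fintype_le _
      _ ≤ ∑ _i : ι, δ := by
        refine Finset.sum_le_sum fun i _ => ?_
        rw [probReal_compl_eq_one_sub (hE i)]
        linarith [hδ i]
      _ = Fintype.card ι * δ := by simp
  rw [probReal_compl_eq_one_sub (MeasurableSet.iInter hE)] at hcompl
  linarith

/-- A relative error at most `ε` on a positive quantity, as a two-sided bound. -/
theorem bounds_of_abs_div_sub_one_le {a n ε : ℝ} (hn : 0 < n) (h : |a / n - 1| ≤ ε) :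
    (1 - ε) * n ≤ a ∧ a ≤ (1 + ε) * n := by
  obtain ⟨h₁, h₂⟩ := abs_le.mp h
  exact ⟨(le_div_iff₀ hn).mp (by linarith), (div_le_iff₀ hn).mp (by linarith)⟩

/-- The relative error of a ratio whose numerator and denominator have relative error at most
`ε`. -/
theorem div_bounds_of_abs_div_sub_one_le {a b m n ε : ℝ} (hε0 : 0 ≤ ε) (hε1 : ε < 1)
    (hm : 0 < m) (hn : 0 < n) (ha : |a / m - 1| ≤ ε) (hb : |b / n - 1| ≤ ε) :
    (1 - 2 * ε) * (m / n) ≤ a / b ∧ a / b ≤ (1 + 2 * ε / (1 - ε)) * (m / n) := by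
  obtain ⟨ha₁, ha₂⟩ := bounds_of_abs_div_sub_one_le hm ha
  obtain ⟨hb₁, hb₂⟩ := bounds_of_abs_div_sub_one_le hn hb
  have hε : 0 < 1 - ε := by linarith
  have ha_pos : 0 < a := (mul_pos hε hm).trans_le ha₁
  have hb_pos : 0 < b := (mul_pos hε hn).trans_le hb₁
  constructor
  · calc (1 - 2 * ε) * (m / n) ≤ (1 - ε) / (1 + ε) * (m / n) := by
          gcongr
          rw [le_div_iff₀ (by linarith)]
          nlinarith [sq_nonneg ε]
      _ = (1 - ε) * m / ((1 + ε) * n) := div_mul_div_comm _ _ _ _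
      _ ≤ a / b := by gcongr
  · calc a / b ≤ (1 + ε) * m / ((1 - ε) * n) := by gcongr
      _ = (1 + 2 * ε / (1 - ε)) * (m / n) := by
          field_simp
          ring

/-- Theorem 2 of the paper: if the estimated neighbourhood function `Nhat t` has relative
error at most `ε` with respect to `N t` with probability at least `1 - δ`, and both `N`
and `Nhat` attain their maximum at the designated point `D`, then the estimated cdf
`Nhat t / Nhat D` approximates the true cdf `N t / N D` at `k` chosen points
simultaneously with error roughly `2ε` and probability at least `1 - (k+1)δ`. -/
theorem cdf_estimator {Ω : Type*} [MeasureSpace Ω] [IsProbabilityMeasure (ℙ : Measure Ω)]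
    {T : Type*} [Fintype T] [Nonempty T] (D : T)
    (ε δ : ℝ) (hε0 : 0 < ε) (hε1 : ε < 1) (hδ : 0 ≤ δ)
    (N : T → ℝ) (hN : ∀ t, 0 < N t) (hND : ∀ t, N t ≤ N D)
    (Nhat : T → Ω → ℝ) (hmeas : ∀ t, Measurable (Nhat t))
    (hNhatpos : ∀ t ω, 0 < Nhat t ω)
    (hNhatD : ∀ t ω, Nhat t ω ≤ Nhat D ω)
    (hprob : ∀ t, 1 - δ ≤ (ℙ {ω | |Nhat t ω / N t - 1| ≤ ε}).toReal)
    (k : ℕ) (ts : Fin k → T) :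
    1 - (k + 1) * δ ≤
      (ℙ {ω | ∀ i : Fin k,
        (1 - 2 * ε) * (N (ts i) / N D) ≤ Nhat (ts i) ω / Nhat D ω ∧
        Nhat (ts i) ω / Nhat D ω ≤ (1 + 2 * ε / (1 - ε)) * (N (ts i) / N D)}).toReal := by
  let point : Option (Fin k) → T := fun o => o.elim D ts
  have hunion := one_sub_card_mul_le_measureReal_iInter (ℙ : Measure Ω)
    (E := fun o => {ω | |Nhat (point o) ω / N (point o) - 1| ≤ ε})
    (fun o => measurableSet_le (((hmeas _).div_const _).sub_const _).abs measurable_const)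
    (fun o => hprob (point o))
  rw [Fintype.card_option, Fintype.card_fin, Nat.cast_succ] at hunion
  refine hunion.trans (measureReal_mono fun ω hω i => ?_)
  rw [Set.mem_iInter] at hω
  exact div_bounds_of_abs_div_sub_one_le hε0.le hε1 (hN _) (hN D) (hω (some i)) (hω none)
end

section
/- Let D ≥ 1 be a natural number and ε ≥ 0. Let h : ℕ → ℝ be nonnegative with ∑_{t=0}^{D} h(t) = 1, and let ĥ : ℕ → ℝ satisfy |ĥ(t) − h(t)| ≤ 2ε for all 0 ≤ t ≤ D. Define Var(f) = ∑_{t=0}^{D} t²·f(t) − (∑_{t=0}^{D} t·f(t))². Then Var(h) − 8ε·D³ − 4ε²·D⁴ ≤ Var(ĥ) ≤ Var(h) + 8ε·D³. -/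
theorem abs_sum_mul_le_of_abs_le_mul_id {D : ℕ} (hD : 1 ≤ D) {c δ : ℝ} (hc : 0 ≤ c)
    {w e : ℕ → ℝ} (hw : ∀ t ≤ D, |w t| ≤ c * t) (he : ∀ t ≤ D, |e t| ≤ δ) :
    |∑ t ∈ Finset.range (D + 1), w t * e t| ≤ c * δ * (D : ℝ) ^ 2 := by
  have hδ : 0 ≤ δ := (abs_nonneg _).trans (he 0 D.zero_le)
  have hD' : (1 : ℝ) ≤ D := by exact_mod_cast hD
  have hgauss : ∑ t ∈ Finset.range (D + 1), (t : ℝ) ≤ (D : ℝ) ^ 2 := by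
    have hid : (∑ t ∈ Finset.range (D + 1), (t : ℝ)) * 2 = (D + 1) * D := by
      have hnat := Finset.sum_range_id_mul_two (D + 1)
      rw [Nat.add_sub_cancel] at hnat
      rw [← Nat.cast_sum]
      exact_mod_cast hnat
    nlinarith
  calc |∑ t ∈ Finset.range (D + 1), w t * e t|
      ≤ ∑ t ∈ Finset.range (D + 1), |w t * e t| := Finset.abs_sum_le_sum_abs _ _
    _ ≤ ∑ t ∈ Finset.range (D + 1), c * δ * (t : ℝ) := by
        refine Finset.sum_le_sum fun t ht => ?_
        have htD : t ≤ D := Finset.mem_range_succ_iff.mp ht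
        calc |w t * e t| = |w t| * |e t| := abs_mul _ _
          _ ≤ c * t * δ := mul_le_mul (hw t htD) (he t htD) (abs_nonneg _) (by positivity)
          _ = c * δ * t := by ring
    _ = c * δ * ∑ t ∈ Finset.range (D + 1), (t : ℝ) := (Finset.mul_sum _ _ _).symm
    _ ≤ c * δ * (D : ℝ) ^ 2 := by gcongr


/-- Lemma 2 of the paper: if `hhat` approximates the probability mass function `h`
(supported on `{0, …, D}`) with pointwise additive error `2ε`, then the variance of
`hhat` approximates the variance of `h` within `[−8εD³ − 4ε²D⁴, +8εD³]`. -/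
theorem variance_estimation_error (D : ℕ) (hD : 1 ≤ D) (ε : ℝ) (hε : 0 ≤ ε)
    (h hhat : ℕ → ℝ) (hpos : ∀ t, 0 ≤ h t)
    (hsum : ∑ t ∈ Finset.range (D + 1), h t = 1)
    (herr : ∀ t ≤ D, |hhat t - h t| ≤ 2 * ε)
    (Var : (ℕ → ℝ) → ℝ)
    (hVar : ∀ f, Var f = (∑ t ∈ Finset.range (D + 1), (t : ℝ) ^ 2 * f t) -
      (∑ t ∈ Finset.range (D + 1), (t : ℝ) * f t) ^ 2) :
    Var h - 8 * ε * (D : ℝ) ^ 3 - 4 * ε ^ 2 * (D : ℝ) ^ 4 ≤ Var hhat ∧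
    Var hhat ≤ Var h + 8 * ε * (D : ℝ) ^ 3 := by
  have hD0 : (0 : ℝ) ≤ D := D.cast_nonneg
  obtain ⟨m, hm⟩ : ∃ m, m = ∑ t ∈ Finset.range (D + 1), (t : ℝ) * h t := ⟨_, rfl⟩
  have hm0 : 0 ≤ m := hm ▸ Finset.sum_nonneg fun t _ => mul_nonneg t.cast_nonneg (hpos t)
  have hmD : m ≤ D := by
    calc m ≤ ∑ t ∈ Finset.range (D + 1), (D : ℝ) * h t := by
          rw [hm]
          refine Finset.sum_le_sum fun t ht => mul_le_mul_of_nonneg_right ?_ (hpos t)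
          exact_mod_cast Finset.mem_range_succ_iff.mp ht
      _ = D := by rw [← Finset.mul_sum, hsum, mul_one]
  have hlin : |∑ t ∈ Finset.range (D + 1), ((t : ℝ) ^ 2 - 2 * m * t) * (hhat t - h t)|
      ≤ 2 * D * (2 * ε) * (D : ℝ) ^ 2 := by
    refine abs_sum_mul_le_of_abs_le_mul_id hD (by positivity) (fun t ht => ?_) herr
    have ht0 : (0 : ℝ) ≤ t := t.cast_nonneg
    have htD : (t : ℝ) ≤ D := by exact_mod_cast ht
    rw [abs_le]
    constructor <;> nlinarith
  have hmean : |∑ t ∈ Finset.range (D + 1), (t : ℝ) * (hhat t - h t)|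
      ≤ 1 * (2 * ε) * (D : ℝ) ^ 2 :=
    abs_sum_mul_le_of_abs_le_mul_id hD zero_le_one (fun t _ => by simp) herr
  have hdiff : Var hhat - Var h =
      (∑ t ∈ Finset.range (D + 1), ((t : ℝ) ^ 2 - 2 * m * t) * (hhat t - h t)) -
        (∑ t ∈ Finset.range (D + 1), (t : ℝ) * (hhat t - h t)) ^ 2 := by
    have hsplit : ∑ t ∈ Finset.range (D + 1), ((t : ℝ) ^ 2 - 2 * m * t) * (hhat t - h t) =
        (∑ t ∈ Finset.range (D + 1), (t : ℝ) ^ 2 * (hhat t - h t)) -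
          2 * m * ∑ t ∈ Finset.range (D + 1), (t : ℝ) * (hhat t - h t) := by
      rw [Finset.mul_sum, ← Finset.sum_sub_distrib]
      exact Finset.sum_congr rfl fun t _ => by ring
    rw [hVar, hVar, hsplit]
    simp only [mul_sub, Finset.sum_sub_distrib, ← hm]
    ring
  have hsq := sq_le_sq' (abs_le.mp hmean).1 (abs_le.mp hmean).2
  have hεD : 0 ≤ ε * (D : ℝ) ^ 3 := by positivity
  obtain ⟨hlo, hhi⟩ := abs_le.mp hlin
  constructor
  · linarith
  · linarith [sq_nonneg (∑ t ∈ Finset.range (D + 1), (t : ℝ) * (hhat t - h t))]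
end

section
/- Let V be a finite type, E : V → V → Prop a relation, m a positive natural, and f : V → Fin m × ℕ. Define c : ℕ → V → Fin m → ℕ by: c(0, v, i) = (f v).2 if (f v).1 = i and 0 otherwise; and c(t+1, v, i) = max(c(t, v, i), max over all w with E v w of c(t, w, i)). Then for all t, v, i: c(t, v, i) equals the maximum of (f y).2 over all y ∈ B(v, t) with (f y).1 = i (and equals 0 if there is no such y), where B(v, t) is the set of vertices reachable from v along E in at most t steps. -/
open Classical

/-- The ball of radius `r` around `x` in the directed graph with arc relation `E`:
the set of vertices reachable from `x` along `E` in at most `r` steps. -/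
def ball {V : Type*} (E : V → V → Prop) (x : V) (r : ℕ) : Set V :=
  {y | ∃ k ≤ r, ∃ v : ℕ → V, v 0 = x ∧ v k = y ∧ ∀ i < k, E (v i) (v (i + 1))}

theorem mem_ball_zero {V : Type*} {E : V → V → Prop} {x y : V} : y ∈ ball E x 0 ↔ y = x := by
  constructor
  · rintro ⟨k, hk, p, rfl, rfl, -⟩
    rw [Nat.le_zero.mp hk]
  · rintro rfl
    exact ⟨0, le_rfl, fun _ => y, rfl, rfl, by simp⟩

theorem mem_ball_succ {V : Type*} {E : V → V → Prop} {x y : V} {r : ℕ} :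
    y ∈ ball E x (r + 1) ↔ y ∈ ball E x r ∨ ∃ w, E x w ∧ y ∈ ball E w r := by
  constructor
  · rintro ⟨k, hk, p, rfl, rfl, hp⟩
    cases k with
    | zero => exact Or.inl ⟨0, Nat.zero_le _, p, rfl, rfl, hp⟩
    | succ k =>
      exact Or.inr ⟨p 1, hp 0 k.succ_pos, k, by omega, fun i => p (i + 1), rfl, rfl,
        fun i hi => hp (i + 1) (by omega)⟩
  · rintro (⟨k, hk, p, h0, hy, hp⟩ | ⟨w, hw, k, hk, p, rfl, rfl, hp⟩)
    · exact ⟨k, by omega, p, h0, hy, hp⟩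
    · refine ⟨k + 1, by omega, fun i => Nat.casesOn i x p, rfl, rfl, fun i hi => ?_⟩
      cases i with
      | zero => exact hw
      | succ i => exact hp i (by omega)

/-- Correctness invariant of HyperANF: after `t` iterations, register `i` of the counter
of node `v` equals the maximum of `(f y).2` over all `y ∈ B(v, t)` with `(f y).1 = i`
(and `0` if there is no such `y`). -/
theorem hyperANF_invariant {V : Type*} [Fintype V] (E : V → V → Prop)
    (m : ℕ) (hm : 0 < m) (f : V → Fin m × ℕ)
    (c : ℕ → V → Fin m → ℕ)
    (hc0 : ∀ v i, c 0 v i = if (f v).1 = i then (f v).2 else 0)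
    (hcs : ∀ t v i, c (t + 1) v i =
      max (c t v i) ((Finset.univ.filter fun w => E v w).sup fun w => c t w i))
    (t : ℕ) (v : V) (i : Fin m) :
    c t v i =
      (Finset.univ.filter fun y => y ∈ ball E v t ∧ (f y).1 = i).sup fun y => (f y).2 := by
  refine eq_of_forall_ge_iff fun n => ?_
  simp only [Finset.sup_le_iff, Finset.mem_filter, Finset.mem_univ, true_and]
  induction t generalizing v with
  | zero =>
    rw [hc0]
    split_ifs with h <;> simp [mem_ball_zero, h]
  | succ t ih =>
    simp only [hcs, max_le_iff, Finset.sup_le_iff, Finset.mem_filter, Finset.mem_univ, true_and,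
      ih, mem_ball_succ]
    grind
end

section
/- For natural numbers ℓ ≥ 1 and k = 2ℓ² + 5ℓ + 2, consider the graph G_{k,ℓ} and its neighbourhood function N. Then: (i) N(t) = N(ℓ+1) for all t ≥ ℓ+1, so max_t N(t) = N(ℓ+1); (ii) 10·N(ℓ) < 9·N(ℓ+1), while N(ℓ+1) ≥ (9/10)·N(ℓ+1), so the least t with 10·N(t) ≥ 9·max_t N(t) is exactly ℓ+1 (the effective diameter at 0.9 is ℓ+1); and (iii) 10·N(1) ≥ 9·N(ℓ) and 10·N(0) < 9·N(ℓ), so if the computation is stopped at iteration ℓ and N(ℓ) is used as the normalisation constant, the least t with 10·N(t) ≥ 9·N(ℓ) is 1 (the estimated effective diameter is 1). -/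
/-- The arc relation of the graph `G_{k,ℓ}` of the paper: two `k`-cliques
(`Sum.inl` and `Sum.inr ∘ Sum.inr`) joined by a unidirectional path of `ℓ` nodes
(`Sum.inr ∘ Sum.inl`, with `p₁` corresponding to index `0` and `p_ℓ` to index `ℓ - 1`). -/
def Gkl (k l : ℕ) : (Fin k ⊕ Fin l ⊕ Fin k) → (Fin k ⊕ Fin l ⊕ Fin k) → Prop
  | Sum.inl i, Sum.inl j => i ≠ j
  | Sum.inl _, Sum.inr (Sum.inl p) => (p : ℕ) = 0
  | Sum.inr (Sum.inl p), Sum.inr (Sum.inl q) => (q : ℕ) = (p : ℕ) + 1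
  | Sum.inr (Sum.inl p), Sum.inr (Sum.inr _) => (p : ℕ) = l - 1
  | Sum.inr (Sum.inr i), Sum.inr (Sum.inr j) => i ≠ j
  | _, _ => False

/-- The neighbourhood function of `G_{k,ℓ}`: the number of ordered pairs `(x, y)` of
vertices with `y` reachable from `x` in at most `t` steps. -/
noncomputable def NGkl (k l t : ℕ) : ℕ :=
  {p : (Fin k ⊕ Fin l ⊕ Fin k) × (Fin k ⊕ Fin l ⊕ Fin k) |
    p.2 ∈ ball (Gkl k l) p.1 t}.ncard

/-- The position of a vertex of `G_{k,ℓ}` along the path: `0` on the first clique, `i` at `pᵢ`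
and `ℓ + 1` on the second clique. -/
def GklLevel (k l : ℕ) : Fin k ⊕ Fin l ⊕ Fin k → ℕ
  | Sum.inl _ => 0
  | Sum.inr (Sum.inl p) => p + 1
  | Sum.inr (Sum.inr _) => l + 1

theorem GklLevel_le (k l : ℕ) (x : Fin k ⊕ Fin l ⊕ Fin k) : GklLevel k l x ≤ l + 1 := by
  rcases x with i | p | i <;> simp only [GklLevel] <;> omega

theorem Gkl_iff {k l : ℕ} (hl : 1 ≤ l) (x y : Fin k ⊕ Fin l ⊕ Fin k) :
    Gkl k l x y ↔ x ≠ y ∧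
      (GklLevel k l x = GklLevel k l y ∨ GklLevel k l y = GklLevel k l x + 1) := by
  rcases x with i | p | i <;> rcases y with j | q | j <;>
    simp [Gkl, GklLevel, Fin.ext_iff] <;> omega

theorem mem_ball_self {V : Type*} (E : V → V → Prop) (x : V) (r : ℕ) : x ∈ ball E x r :=
  ⟨0, r.zero_le, fun _ => x, rfl, rfl, by simp⟩

theorem mem_ball_succ_of_arc {V : Type*} {E : V → V → Prop} {x y z : V} {r : ℕ}
    (hy : y ∈ ball E x r) (hyz : E y z) : z ∈ ball E x (r + 1) := by
  obtain ⟨k, hk, v, h0, hvk, hv⟩ := hy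
  refine ⟨k + 1, by omega, fun i => if i ≤ k then v i else z, by simpa using h0, by simp, ?_⟩
  intro i hi
  rcases Nat.lt_or_ge i k with h | h
  · simpa [h.le, Nat.succ_le_of_lt h] using hv i h
  · obtain rfl : i = k := by omega
    simpa [hvk] using hyz

theorem level_bounds_of_mem_ball {k l : ℕ} (hl : 1 ≤ l) {x y : Fin k ⊕ Fin l ⊕ Fin k} {r : ℕ}
    (h : y ∈ ball (Gkl k l) x r) :
    GklLevel k l x ≤ GklLevel k l y ∧ GklLevel k l y ≤ GklLevel k l x + r := by
  obtain ⟨n, hn, v, rfl, rfl, hv⟩ := h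
  have key : ∀ m ≤ n, GklLevel k l (v 0) ≤ GklLevel k l (v m) ∧
      GklLevel k l (v m) ≤ GklLevel k l (v 0) + m := by
    intro m
    induction m with
    | zero => simp
    | succ m ih =>
      intro hm
      have h₁ := ih (by omega)
      have h₂ := ((Gkl_iff hl _ _).1 (hv m (by omega))).2
      omega
  have := key n le_rfl
  omega

theorem mem_ball_of_level_lt {k l : ℕ} (hl : 1 ≤ l) (x : Fin k ⊕ Fin l ⊕ Fin k) (r : ℕ) :
    ∀ y, GklLevel k l x < GklLevel k l y → GklLevel k l y ≤ GklLevel k l x + r →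
      y ∈ ball (Gkl k l) x r := by
  induction r with
  | zero => intro y _ _; omega
  | succ r ih =>
    intro y hxy hyr
    have ne_of_lt : ∀ z, GklLevel k l z < GklLevel k l y → z ≠ y := by
      rintro z hz rfl
      exact hz.false
    by_cases h : GklLevel k l y = GklLevel k l x + 1
    · exact mem_ball_succ_of_arc (mem_ball_self _ x r)
        ((Gkl_iff hl _ _).2 ⟨ne_of_lt x hxy, .inr h⟩)
    · have hy := GklLevel_le k l y
      let z : Fin k ⊕ Fin l ⊕ Fin k := .inr (.inl ⟨GklLevel k l y - 2, by omega⟩)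
      have hz : GklLevel k l z = GklLevel k l y - 2 + 1 := rfl
      exact mem_ball_succ_of_arc (ih z (by omega) (by omega))
        ((Gkl_iff hl _ _).2 ⟨ne_of_lt z (by omega), .inr (by omega)⟩)

theorem mem_ball_Gkl_iff {k l : ℕ} (hl : 1 ≤ l) (x y : Fin k ⊕ Fin l ⊕ Fin k) (r : ℕ) :
    y ∈ ball (Gkl k l) x r ↔ x = y ∨ (1 ≤ r ∧ GklLevel k l x = GklLevel k l y) ∨
      (GklLevel k l x < GklLevel k l y ∧ GklLevel k l y ≤ GklLevel k l x + r) := by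
  constructor
  · intro h
    have hb := level_bounds_of_mem_ball hl h
    rcases Nat.eq_zero_or_pos r with rfl | hr
    · obtain ⟨n, hn, v, rfl, rfl, -⟩ := h
      obtain rfl : n = 0 := by omega
      exact .inl rfl
    · right; omega
  · rintro (rfl | ⟨hr, h⟩ | ⟨h₁, h₂⟩)
    · exact mem_ball_self _ _ _
    · by_cases hxy : x = y
      · exact hxy ▸ mem_ball_self _ _ _
      · obtain ⟨r, rfl⟩ := Nat.exists_eq_add_of_le' hr
        exact mem_ball_succ_of_arc (mem_ball_self _ x r) ((Gkl_iff hl _ _).2 ⟨hxy, .inl h⟩)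
    · exact mem_ball_of_level_lt hl x r y h₁ h₂

theorem NGkl_mono (k l : ℕ) : Monotone (NGkl k l) := by
  intro s t hst
  refine Set.ncard_le_ncard ?_ (Set.toFinite _)
  rintro p ⟨n, hn, h⟩
  exact ⟨n, hn.trans hst, h⟩

theorem NGkl_eq_of_le {k l : ℕ} (hl : 1 ≤ l) {t : ℕ} (ht : l + 1 ≤ t) :
    NGkl k l t = NGkl k l (l + 1) := by
  unfold NGkl
  congr 1
  ext ⟨x, y⟩
  have hy := GklLevel_le k l y
  simp only [Set.mem_ofPred_eq, mem_ball_Gkl_iff hl]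
  refine or_congr_right ?_
  omega

theorem NGkl_eq_sum {k l : ℕ} (hl : 1 ≤ l) (t : ℕ) :
    NGkl k l t = ∑ x, ∑ y, if x = y ∨ (1 ≤ t ∧ GklLevel k l x = GklLevel k l y) ∨
      (GklLevel k l x < GklLevel k l y ∧ GklLevel k l y ≤ GklLevel k l x + t) then 1 else 0 := by
  classical
  simp only [NGkl, mem_ball_Gkl_iff hl]
  rw [Set.ncard_eq_toFinset_card', Set.toFinset_ofPred, Finset.card_filter,
    Fintype.sum_prod_type]

theorem NGkl_zero {k l : ℕ} (hl : 1 ≤ l) : NGkl k l 0 = 2 * k + l := by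
  rw [NGkl_eq_sum hl]
  have h : ∀ a b : ℕ, ¬ (a < b ∧ b ≤ a) := by omega
  simp [h]
  ring

/-- The number of pairs at distance at most `t` in `G_{k,ℓ}` with at least one vertex on the path,
when `1 ≤ t`. -/
def GklPathPairs (k l t : ℕ) : ℕ :=
  k * (∑ p : Fin l, if (p : ℕ) + 1 ≤ t then 1 else 0) +
  (∑ p : Fin l, ∑ q : Fin l, if p ≤ q ∧ (q : ℕ) ≤ p + t then 1 else 0) +
  (∑ p : Fin l, if l ≤ p + t then 1 else 0) * k

theorem GklPathPairs_le (k l t : ℕ) : GklPathPairs k l t ≤ 2 * k * l + l ^ 2 := by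
  have h : ∀ (P : Fin l → Prop) [DecidablePred P], (∑ p, if P p then 1 else 0) ≤ l := by
    intro P _
    simpa using Finset.card_filter_le Finset.univ P
  have h₂ : (∑ p : Fin l, ∑ q : Fin l, if p ≤ q ∧ (q : ℕ) ≤ p + t then 1 else 0) ≤ l * l := by
    simpa using Finset.sum_le_card_nsmul Finset.univ _ l fun p _ =>
      h fun q : Fin l => p ≤ q ∧ (q : ℕ) ≤ p + t
  have h₁ := Nat.mul_le_mul_left k (h fun p => (p : ℕ) + 1 ≤ t)
  have h₃ := Nat.mul_le_mul_right k (h fun p => l ≤ p + t)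
  unfold GklPathPairs
  linarith

theorem GklPathPairs_succ (k l : ℕ) : GklPathPairs k l (l + 1) = GklPathPairs k l l := by
  have h₁ : ∀ p : Fin l, (p : ℕ) + 1 ≤ l + 1 ↔ (p : ℕ) + 1 ≤ l := by omega
  have h₂ : ∀ p q : Fin l, (q : ℕ) ≤ p + (l + 1) ↔ (q : ℕ) ≤ p + l := by omega
  have h₃ : ∀ p : Fin l, l ≤ p + (l + 1) ↔ l ≤ p + l := by omega
  simp only [GklPathPairs, h₁, h₂, h₃]

theorem NGkl_eq {k l : ℕ} (hl : 1 ≤ l) {t : ℕ} (ht : 1 ≤ t) :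
    NGkl k l t = 2 * k ^ 2 + (if l + 1 ≤ t then k ^ 2 else 0) + GklPathPairs k l t := by
  have hpp : ∀ p q : Fin l, (p = q ∨ (p : ℕ) + 1 = q + 1 ∨
      ((p : ℕ) + 1 < q + 1 ∧ (q : ℕ) + 1 ≤ p + 1 + t)) ↔ p ≤ q ∧ (q : ℕ) ≤ p + t := by
    intro p q
    omega
  have hpb : ∀ p : Fin l, ((p : ℕ) + 1 = l + 1 ∨
      ((p : ℕ) + 1 < l + 1 ∧ l + 1 ≤ (p : ℕ) + 1 + t)) ↔ l ≤ p + t := by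
    intro p
    omega
  have hbp : ∀ p : Fin l, ¬ (l + 1 = (p : ℕ) + 1 ∨
      (l + 1 < (p : ℕ) + 1 ∧ (p : ℕ) + 1 ≤ l + 1 + t)) := by
    intro p
    omega
  rw [NGkl_eq_sum hl]
  simp only [Fintype.sum_sum_type, GklLevel, ht, hpp, hpb, hbp, GklPathPairs, Sum.inr.injEq,
    Sum.inl.injEq, reduceCtorEq, true_and, false_or, true_or, or_true, if_true, if_false,
    Finset.sum_const, Finset.card_univ, Fintype.card_fin, smul_eq_mul, zero_add,
    Finset.sum_add_distrib, ← Finset.mul_sum, Nat.succ_pos, Nat.not_lt_zero, false_and, mul_zero]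
  split_ifs <;> ring

/-- For `k = 2ℓ² + 5ℓ + 2`: (i) `N` stabilises at `ℓ+1`, so `max N = N(ℓ+1)`;
(ii) `10·N(ℓ) < 9·N(ℓ+1)` while `N(ℓ+1) ≥ (9/10)·N(ℓ+1)`, so the least `t` with
`10·N(t) ≥ 9·max N` (the effective diameter at `0.9`) is exactly `ℓ+1`;
(iii) `10·N(1) ≥ 9·N(ℓ)` and `10·N(0) < 9·N(ℓ)`, so normalising by `N(ℓ)` instead
yields `1` as the least such `t`. -/
theorem effective_diameter_counterexample (l : ℕ) (hl : 1 ≤ l)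
    (k : ℕ) (hk : k = 2 * l ^ 2 + 5 * l + 2) :
    (∀ t : ℕ, l + 1 ≤ t → NGkl k l t = NGkl k l (l + 1)) ∧
    10 * NGkl k l l < 9 * NGkl k l (l + 1) ∧
    9 * NGkl k l (l + 1) ≤ 10 * NGkl k l (l + 1) ∧
    IsLeast {t : ℕ | 9 * NGkl k l (l + 1) ≤ 10 * NGkl k l t} (l + 1) ∧
    10 * NGkl k l 0 < 9 * NGkl k l l ∧
    9 * NGkl k l l ≤ 10 * NGkl k l 1 ∧
    IsLeast {t : ℕ | 9 * NGkl k l l ≤ 10 * NGkl k l t} 1 := by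
  have hN₀ := NGkl_zero (k := k) hl
  have hN₁ := NGkl_eq (k := k) hl le_rfl
  have hNl := NGkl_eq (k := k) hl hl
  have hNs := NGkl_eq (k := k) hl (Nat.le_add_left 1 l)
  rw [if_neg (by omega)] at hN₁ hNl
  rw [if_pos le_rfl, GklPathPairs_succ] at hNs
  have hR := GklPathPairs_le k l l
  have hkl : l ^ 2 + 5 * l + 2 ≤ k := by
    rw [hk]
    linarith [Nat.zero_le (l ^ 2)]
  have hlow : 10 * NGkl k l l < 9 * NGkl k l (l + 1) := by
    nlinarith
  have hzero : 10 * NGkl k l 0 < 9 * NGkl k l l := by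
    nlinarith
  have hone : 9 * NGkl k l l ≤ 10 * NGkl k l 1 := by
    rcases hl.eq_or_lt with rfl | hl'
    · omega
    · have : 18 * k * l + 9 * l ^ 2 ≤ 2 * k ^ 2 := by
        obtain ⟨m, rfl⟩ := Nat.exists_eq_add_of_le' hl'
        rw [hk]
        nlinarith [Nat.zero_le m, Nat.zero_le (m ^ 2), Nat.zero_le (m ^ 3), Nat.zero_le (m ^ 4)]
      linarith
  refine ⟨fun t ht => NGkl_eq_of_le hl ht, hlow, by omega, ⟨?_, ?_⟩, hzero, hone, hone, ?_⟩
  · simp only [Set.mem_ofPred_eq]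
    omega
  · intro t ht
    by_contra! h
    have := NGkl_mono k l (Nat.le_of_lt_succ h)
    simp only [Set.mem_ofPred_eq] at ht
    omega
  · intro t ht
    by_contra! h
    obtain rfl : t = 0 := by omega
    simp only [Set.mem_ofPred_eq] at ht
    omega
end

section
/- Let k ≥ 1 and n ≥ 1 be natural numbers and w = n·k. Let H : BitVec w be the word whose set bits are exactly those in positions j·k + (k−1) for 0 ≤ j < n. Then for all x, y : BitVec w, the word z = ((((x ||| H) − (y &&& ~H)) ||| (x ^^^ y)) ^^^ (x ||| ~y)) &&& H satisfies: for every j < n, the bit of z in position j·k + (k−1) is 1 if and only if the unsigned value of the j-th k-bit block of x (bits j·k, …, j·k + k − 1) is strictly smaller than the unsigned value of the j-th k-bit block of y; and all bits of z in positions not of the form j·k + (k−1) are 0. -/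
/-- The bit of a difference is the exclusive or of the operand bits and the incoming borrow. -/
theorem BitVec.getLsbD_sub_eq_xor_borrow {w : ℕ} (a b : BitVec w) {p : ℕ} (hp : p < w) :
    (a - b).getLsbD p =
      ((a.getLsbD p ^^ b.getLsbD p) ^^ decide (a.toNat % 2 ^ p < b.toNat % 2 ^ p)) := by
  obtain ⟨c, rfl⟩ : ∃ c, a = c + b := ⟨a - b, by simp⟩
  have hmod : (c + b).toNat % 2 ^ p = (c.toNat % 2 ^ p + b.toNat % 2 ^ p) % 2 ^ p := by
    rw [BitVec.toNat_add, Nat.mod_mod_of_dvd _ (pow_dvd_pow 2 hp.le), Nat.add_mod]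
  have hborrow : decide ((c + b).toNat % 2 ^ p < b.toNat % 2 ^ p) = BitVec.carry p c b false := by
    rw [hmod, BitVec.carry, decide_eq_decide]
    have hc := Nat.mod_lt c.toNat (Nat.two_pow_pos p)
    have hb := Nat.mod_lt b.toNat (Nat.two_pow_pos p)
    simp only [Bool.toNat_false, add_zero, ge_iff_le]
    rcases lt_or_ge (c.toNat % 2 ^ p + b.toNat % 2 ^ p) (2 ^ p) with h | h
    · rw [Nat.mod_eq_of_lt h]
      omega
    · rw [Nat.mod_eq_sub_mod h, Nat.mod_eq_of_lt (by omega)]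
      omega
  rw [hborrow, BitVec.getLsbD_add hp, BitVec.add_sub_cancel]
  cases c.getLsbD p <;> cases b.getLsbD p <;> cases BitVec.carry p c b false <;> rfl

/-- If no borrow leaves the lowest `q` bits, comparing the lowest `q + m` bits amounts to
comparing the upper `m` of them. -/
theorem Nat.mod_two_pow_add_lt_iff {a b q : ℕ} (m : ℕ) (h : b % 2 ^ q ≤ a % 2 ^ q) :
    a % 2 ^ (q + m) < b % 2 ^ (q + m) ↔ a / 2 ^ q % 2 ^ m < b / 2 ^ q % 2 ^ m := by
  rw [pow_add, Nat.mod_mul, Nat.mod_mul]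
  have ha := Nat.mod_lt a (Nat.two_pow_pos q)
  have hb := Nat.mod_lt b (Nat.two_pow_pos q)
  generalize a / 2 ^ q % 2 ^ m = u
  generalize b / 2 ^ q % 2 ^ m = v
  constructor
  · intro hlt
    exact Nat.lt_of_mul_lt_mul_left (a := 2 ^ q) (by omega)
  · intro hlt
    have := Nat.mul_le_mul_left (2 ^ q) (Nat.succ_le_of_lt hlt)
    rw [Nat.mul_succ] at this
    omega

/-- The lowest `m + 1` bits of a number, split at the highest of them. -/
theorem Nat.mod_two_pow_succ_eq_testBit (a m : ℕ) :
    a % 2 ^ (m + 1) = a % 2 ^ m + 2 ^ m * (a.testBit m).toNat := by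
  rw [pow_succ, Nat.mod_mul, Nat.toNat_testBit]

/-- A number whose bit `m` is clear is at most a number whose bit `m` is set, modulo
`2 ^ (m + 1)`. -/
theorem Nat.mod_two_pow_succ_le_of_testBit {a b m : ℕ} (ha : a.testBit m = true)
    (hb : b.testBit m = false) : b % 2 ^ (m + 1) ≤ a % 2 ^ (m + 1) := by
  have := Nat.mod_lt b (Nat.two_pow_pos m)
  simp only [Nat.mod_two_pow_succ_eq_testBit, ha, hb, Bool.toNat_true, Bool.toNat_false]
  omega

/-- Comparison of the lowest `m + 1` bits, by the highest bits first. -/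
theorem Nat.mod_two_pow_succ_lt_iff (a b m : ℕ) :
    a % 2 ^ (m + 1) < b % 2 ^ (m + 1) ↔
      ((!(decide (a % 2 ^ m < b % 2 ^ m)) || (a.testBit m ^^ b.testBit m)) ^^
        (a.testBit m || !b.testBit m)) = true := by
  have ha := Nat.mod_lt a (Nat.two_pow_pos m)
  have hb := Nat.mod_lt b (Nat.two_pow_pos m)
  rw [Nat.mod_two_pow_succ_eq_testBit, Nat.mod_two_pow_succ_eq_testBit]
  cases a.testBit m <;> cases b.testBit m <;> simp <;> omega

/-- Words agreeing on the bits `q, …, q + m - 1` have the same value there. -/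
theorem BitVec.toNat_div_mod_two_pow_congr {w q m : ℕ} {a b : BitVec w}
    (h : ∀ i < m, a.getLsbD (q + i) = b.getLsbD (q + i)) :
    a.toNat / 2 ^ q % 2 ^ m = b.toNat / 2 ^ q % 2 ^ m := by
  refine Nat.eq_of_testBit_eq fun i => ?_
  rw [Nat.testBit_mod_two_pow, Nat.testBit_mod_two_pow, Nat.testBit_div_two_pow,
    Nat.testBit_div_two_pow, add_comm i q]
  by_cases hi : i < m
  · simp only [hi, decide_true, Bool.true_and, BitVec.testBit_toNat, h i hi]
  · simp [hi]


/-- The broadword parallel unsigned comparison formula `x <ᵏᵤ y`: for `w = n·k`-bit words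
and `H` the constant with exactly the highest bit of each `k`-bit subword set, the word
`z = ((((x ||| H) - (y &&& ~~~H)) ||| (x ^^^ y)) ^^^ (x ||| ~~~y)) &&& H` has, in the highest
bit of each `k`-bit block, the result of the unsigned comparison of the corresponding
blocks of `x` and `y`, and zeroes elsewhere. -/
theorem broadword_parallel_comparison (k n : ℕ) (hk : 1 ≤ k) (hn : 1 ≤ n)
    (H : BitVec (n * k))
    (hH : ∀ p < n * k, (H.getLsbD p = true ↔ ∃ j < n, p = j * k + (k - 1)))
    (x y : BitVec (n * k)) :
    let z := ((((x ||| H) - (y &&& ~~~H)) ||| (x ^^^ y)) ^^^ (x ||| ~~~y)) &&& H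
    (∀ j < n, (z.getLsbD (j * k + (k - 1)) = true ↔
      (BitVec.extractLsb' (j * k) k x).toNat < (BitVec.extractLsb' (j * k) k y).toNat)) ∧
    (∀ p < n * k, (¬ ∃ j < n, p = j * k + (k - 1)) → z.getLsbD p = false) := by
  intro z
  obtain ⟨m, rfl⟩ : ∃ m, k = m + 1 := ⟨k - 1, by omega⟩
  simp only [Nat.add_sub_cancel] at hH ⊢
  refine ⟨fun j hj => ?_, fun p hp hne => ?_⟩
  · have hblock : j * (m + 1) + (m + 1) ≤ n * (m + 1) := by
      rw [← Nat.succ_mul]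
      exact Nat.mul_le_mul_right _ hj
    have hp : j * (m + 1) + m < n * (m + 1) := by omega
    have hH_top : H.getLsbD (j * (m + 1) + m) = true := (hH _ hp).2 ⟨j, hj, rfl⟩
    have hH_low : ∀ i < m, H.getLsbD (j * (m + 1) + i) = false := by
      intro i hi
      rw [← Bool.not_eq_true, hH _ (by omega)]
      rintro ⟨l, -, hl⟩
      have hmod := congrArg (· % (m + 1)) hl
      simp only [Nat.mul_add_mod_self_right, Nat.mod_eq_of_lt (Nat.lt_succ_self m),
        Nat.mod_eq_of_lt (show i < m + 1 by omega)] at hmod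
      omega
    have hborrow : (y &&& ~~~H).toNat % 2 ^ (j * (m + 1)) ≤
        (x ||| H).toNat % 2 ^ (j * (m + 1)) := by
      rcases j with _ | l
      · simp [Nat.mod_one]
      · have hl : l * (m + 1) + m < n * (m + 1) := by
          rw [Nat.succ_mul] at hp
          omega
        have hHl : H.getLsbD (l * (m + 1) + m) = true := (hH _ hl).2 ⟨l, by omega, rfl⟩
        rw [Nat.succ_mul, ← add_assoc]
        apply Nat.mod_two_pow_succ_le_of_testBit
        · rw [BitVec.testBit_toNat]
          simp [hHl]
        · rw [BitVec.testBit_toNat]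
          simp [hHl]
    have hx_low : (x ||| H).toNat / 2 ^ (j * (m + 1)) % 2 ^ m =
        x.toNat / 2 ^ (j * (m + 1)) % 2 ^ m :=
      BitVec.toNat_div_mod_two_pow_congr fun i hi => by simp [hH_low i hi]
    have hy_low : (y &&& ~~~H).toNat / 2 ^ (j * (m + 1)) % 2 ^ m =
        y.toNat / 2 ^ (j * (m + 1)) % 2 ^ m :=
      BitVec.toNat_div_mod_two_pow_congr fun i hi => by
        have hlt : j * (m + 1) + i < n * (m + 1) := by omega
        simp only [BitVec.getLsbD_and, BitVec.getLsbD_not, hH_low i hi, hlt, decide_true,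
          Bool.not_false, Bool.and_true]
    have hsub := BitVec.getLsbD_sub_eq_xor_borrow (x ||| H) (y &&& ~~~H) hp
    simp only [Nat.mod_two_pow_add_lt_iff m hborrow, hx_low, hy_low, BitVec.getLsbD_or,
      BitVec.getLsbD_and, BitVec.getLsbD_not, hH_top, hp, Bool.or_true, decide_true,
      Bool.not_true, Bool.and_false, Bool.xor_false, Bool.true_xor] at hsub
    rw [BitVec.extractLsb'_toNat, BitVec.extractLsb'_toNat, Nat.shiftRight_eq_div_pow,
      Nat.shiftRight_eq_div_pow, Nat.mod_two_pow_succ_lt_iff, Nat.testBit_div_two_pow,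
      Nat.testBit_div_two_pow, BitVec.testBit_toNat, BitVec.testBit_toNat,
      add_comm m (j * (m + 1))]
    simp only [z, BitVec.getLsbD_and, BitVec.getLsbD_or, BitVec.getLsbD_xor,
      BitVec.getLsbD_not, hsub, hH_top, hp, decide_true, Bool.true_and, Bool.and_true]
  · have hHp : H.getLsbD p = false := by
      rw [← Bool.not_eq_true, hH p hp]
      exact hne
    simp [z, hHp]
end

section
/- Let k ≥ 1 and n ≥ 1 be natural numbers and w = n·k. Let H : BitVec w be the word with set bits exactly in positions j·k + (k−1) for 0 ≤ j < n, and L : BitVec w the word with set bits exactly in positions j·k for 0 ≤ j < n. For x, y : BitVec w, let z = ((((x ||| H) − (y &&& ~H)) ||| (x ^^^ y)) ^^^ (x ||| ~y)) &&& H, and define the mask m = ((((z >>> (k−1)) ||| H) − L) ||| H) ^^^ z. Then for every j < n, the j-th k-bit block of the word (x &&& m) ||| (y &&& ~m) equals the maximum of the j-th k-bit block of x and the j-th k-bit block of y (as unsigned k-bit integers). -/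
namespace Nat

theorem sub_div_of_mod_le {a b m : ℕ} (hm : 0 < m) (h : b % m ≤ a % m) :
    (a - b) / m = a / m - b / m := by
  have ha := Nat.div_add_mod a m
  have hb := Nat.div_add_mod b m
  have hr := Nat.mod_lt a hm
  rcases le_total (b / m) (a / m) with hq | hq
  · obtain ⟨c, hc⟩ := Nat.exists_eq_add_of_le hq
    rw [hc] at ha ⊢
    rw [mul_add] at ha
    rw [Nat.add_sub_cancel_left, Nat.div_eq_iff hm]
    have := mul_comm c m
    omega
  · rw [Nat.sub_eq_zero_of_le hq, Nat.div_eq_of_lt]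
    have := Nat.mul_le_mul_left m hq
    omega

theorem sub_mod_of_mod_le {a b m : ℕ} (hm : 0 < m) (hab : b ≤ a) (h : b % m ≤ a % m) :
    (a - b) % m = a % m - b % m := by
  have h1 := Nat.div_add_mod (a - b) m
  rw [sub_div_of_mod_le hm h, Nat.mul_sub] at h1
  have ha := Nat.div_add_mod a m
  have hb := Nat.div_add_mod b m
  have := Nat.mul_le_mul_left m (Nat.div_le_div_right (c := m) hab)
  omega

end Nat

namespace BitVec

theorem toNat_mod_le_of_extractLsb'_le {w k n : ℕ} {a b : BitVec w}
    (h : ∀ j < n, extractLsb' (j * k) k b ≤ extractLsb' (j * k) k a) :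
    b.toNat % 2 ^ (n * k) ≤ a.toNat % 2 ^ (n * k) := by
  induction n with
  | zero => simp [Nat.mod_one]
  | succ n ih =>
    have h1 := ih fun j hj => h j (by omega)
    have h2 := h n (by omega)
    rw [BitVec.le_def, extractLsb'_toNat, extractLsb'_toNat, Nat.shiftRight_eq_div_pow,
      Nat.shiftRight_eq_div_pow] at h2
    rw [Nat.succ_mul, pow_add, Nat.mod_mul, Nat.mod_mul]
    gcongr

/-- Subtraction acts block by block when no block borrows. -/
theorem extractLsb'_sub_of_le {k n : ℕ} {a b : BitVec (n * k)}
    (h : ∀ j < n, extractLsb' (j * k) k b ≤ extractLsb' (j * k) k a) {j : ℕ} (hj : j < n) :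
    extractLsb' (j * k) k (a - b) = extractLsb' (j * k) k a - extractLsb' (j * k) k b := by
  have hba : b ≤ a := by
    simpa [BitVec.le_def, Nat.mod_eq_of_lt, isLt] using toNat_mod_le_of_extractLsb'_le h
  have hlow := toNat_mod_le_of_extractLsb'_le fun i (hi : i < j) => h i (hi.trans hj)
  have hblock := h j hj
  apply eq_of_toNat_eq
  rw [toNat_sub_of_le hblock]
  rw [BitVec.le_def] at hblock
  simp only [extractLsb'_toNat, Nat.shiftRight_eq_div_pow] at hblock ⊢
  rw [toNat_sub_of_le hba, Nat.sub_div_of_mod_le (by positivity) hlow,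
    Nat.sub_mod_of_mod_le (by positivity) (Nat.div_le_div_right hba) hblock]

theorem and_not_twoPow_le_or_twoPow (m : ℕ) (x y : BitVec (m + 1)) :
    y &&& ~~~twoPow (m + 1) m ≤ x ||| twoPow (m + 1) m := by
  have h1 : (y &&& ~~~twoPow (m + 1) m).msb = false := by
    simp [msb_eq_getLsbD_last]
  have h2 : (x ||| twoPow (m + 1) m).msb = true := by
    simp [msb_eq_getLsbD_last]
  rw [msb_eq_decide] at h1 h2
  simp only [Nat.add_sub_cancel, decide_eq_false_iff_not, decide_eq_true_eq, not_le] at h1 h2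
  exact (h1.trans_le h2).le

theorem msb_or_twoPow_sub (m : ℕ) (x y : BitVec (m + 1)) :
    ((x ||| twoPow (m + 1) m) - (y &&& ~~~twoPow (m + 1) m)).msb =
      decide (y.setWidth m ≤ x.setWidth m) := by
  have hx : x ||| twoPow (m + 1) m = cons true (x.setWidth m) := by
    ext i hi
    simp [getElem_cons]
    grind
  have hy : y &&& ~~~twoPow (m + 1) m = cons false (y.setWidth m) := by
    ext i hi
    simp [getElem_cons]
    grind
  have hle := and_not_twoPow_le_or_twoPow m x y
  rw [msb_eq_decide, toNat_sub_of_le hle, hx, hy, toNat_cons', toNat_cons']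
  simp only [BitVec.le_def, decide_eq_decide]
  have := (y.setWidth m).isLt
  have := (x.setWidth m).isLt
  simp [Nat.shiftLeft_eq]
  omega

theorem lt_iff_msb_setWidth (m : ℕ) (x y : BitVec (m + 1)) :
    x < y ↔ (x.msb = false ∧ y.msb = true) ∨ (x.msb = y.msb ∧ x.setWidth m < y.setWidth m) := by
  rw [BitVec.lt_def, ← cons_msb_setWidth x, ← cons_msb_setWidth y, toNat_cons', toNat_cons']
  have := (y.setWidth m).isLt
  have := (x.setWidth m).isLt
  cases x.msb <;> cases y.msb <;> simp [Nat.shiftLeft_eq, BitVec.lt_def] <;> omega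

/-- The comparison formula for a single block: the highest bit is set exactly when `x < y`. -/
theorem compare_and_twoPow (m : ℕ) (x y : BitVec (m + 1)) :
    ((((x ||| twoPow (m + 1) m) - (y &&& ~~~twoPow (m + 1) m)) ||| (x ^^^ y)) ^^^ (x ||| ~~~y)) &&&
      twoPow (m + 1) m = if x < y then twoPow (m + 1) m else 0#(m + 1) := by
  have ht := msb_or_twoPow_sub m x y
  have hlt := lt_iff_msb_setWidth m x y
  set t := (x ||| twoPow (m + 1) m) - (y &&& ~~~twoPow (m + 1) m)
  rw [and_twoPow]
  congr 1
  simp only [msb_eq_getLsbD_last, Nat.add_sub_cancel] at ht hlt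
  simp only [getLsbD_xor, getLsbD_or, getLsbD_not, ht, hlt]
  cases x.getLsbD m <;> cases y.getLsbD m <;> simp

theorem one_le_or_twoPow (m : ℕ) (x : BitVec (m + 1)) : 1#(m + 1) ≤ x ||| twoPow (m + 1) m := by
  have h : 0 < (x ||| twoPow (m + 1) m).toNat := by
    refine Nat.pos_of_ne_zero fun h => ?_
    simpa using congrArg (getLsbD · m) (toNat_eq.2 (h.trans (toNat_zero (w := m + 1)).symm))
  rw [BitVec.le_def]
  simp only [toNat_ofNat]
  rwa [Nat.mod_eq_of_lt (by simp)]

/-- The mask formula for a single block whose comparison outcome is `p`. -/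
theorem mask_of_comparison (m : ℕ) (p : Prop) [Decidable p] :
    ((((if p then 1#(m + 1) else 0#(m + 1)) ||| twoPow (m + 1) m) - 1#(m + 1)) |||
        twoPow (m + 1) m) ^^^ (if p then twoPow (m + 1) m else 0#(m + 1)) =
      if p then 0#(m + 1) else allOnes (m + 1) := by
  split_ifs
  · rcases m.eq_zero_or_pos with rfl | hm
    · decide
    · have h : 1#(m + 1) ||| twoPow (m + 1) m = twoPow (m + 1) m + 1#(m + 1) := by
        rw [BitVec.add_comm, add_eq_or_of_and_eq_zero]
        ext i hi
        simp
        omega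
      rw [h, BitVec.add_sub_cancel, BitVec.or_self, BitVec.xor_self]
  · have h := one_le_or_twoPow m 0#(m + 1)
    rw [zero_or] at h
    ext i hi
    rw [zero_or, xor_zero, getElem_or, getElem_allOnes, ← getLsbD_eq_getElem, ← testBit_toNat,
      toNat_sub_of_le h, toNat_twoPow_of_lt (by omega), toNat_ofNat,
      Nat.mod_eq_of_lt (by simp), Nat.testBit_two_pow_sub_one, getElem_twoPow]
    simp
    omega

theorem extractLsb'_not_of_le {w s k : ℕ} (x : BitVec w) (h : s + k ≤ w) :
    extractLsb' s k (~~~x) = ~~~extractLsb' s k x := by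
  ext i hi
  simp [show s + i < w by omega]

theorem toNat_select_max {k : ℕ} (x y : BitVec k) :
    ((x &&& if x < y then 0#k else allOnes k) |||
      (y &&& ~~~(if x < y then 0#k else allOnes k))).toNat = max x.toNat y.toNat := by
  split_ifs with h
  · simpa using (BitVec.lt_def.1 h).le
  · simpa using BitVec.le_def.1 (BitVec.not_lt.1 h)

end BitVec

open BitVec

/-- The broadword register-maximisation formula: for `w = n·k`-bit words, with `H` the
constant with the highest bit of each `k`-bit subword set and `L` the constant with the
lowest bit of each `k`-bit subword set, from the parallel comparison word `z` the mask
`m = ((((z >>> (k−1)) ||| H) − L) ||| H) ^^^ z` is built, and then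
`(x &&& m) ||| (y &&& ~~~m)` computes all `n` block-wise unsigned maxima simultaneously. -/
theorem broadword_parallel_max (k n : ℕ) (hk : 1 ≤ k) (hn : 1 ≤ n)
    (H L : BitVec (n * k))
    (hH : ∀ p < n * k, (H.getLsbD p = true ↔ ∃ j < n, p = j * k + (k - 1)))
    (hL : ∀ p < n * k, (L.getLsbD p = true ↔ ∃ j < n, p = j * k))
    (x y : BitVec (n * k)) :
    let z := ((((x ||| H) - (y &&& ~~~H)) ||| (x ^^^ y)) ^^^ (x ||| ~~~y)) &&& H
    let m := ((((z >>> (k - 1)) ||| H) - L) ||| H) ^^^ z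
    ∀ j < n,
      (BitVec.extractLsb' (j * k) k ((x &&& m) ||| (y &&& ~~~m))).toNat =
        max (BitVec.extractLsb' (j * k) k x).toNat (BitVec.extractLsb' (j * k) k y).toNat := by
  intro z m
  obtain ⟨b, rfl⟩ : ∃ b, k = b + 1 := ⟨k - 1, by omega⟩
  simp only [Nat.add_sub_cancel] at hH
  have hend : ∀ j < n, j * (b + 1) + (b + 1) ≤ n * (b + 1) := fun j hj => by
    rw [← Nat.succ_mul]
    exact Nat.mul_le_mul_right _ hj
  have offset_unique {i j c d : ℕ} (hc : c < b + 1) (hd : d < b + 1)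
      (h : i * (b + 1) + c = j * (b + 1) + d) : c = d := by
    simpa only [Nat.mul_add_mod', Nat.mod_eq_of_lt hc, Nat.mod_eq_of_lt hd] using
      congrArg (· % (b + 1)) h
  have bH : ∀ j < n, extractLsb' (j * (b + 1)) (b + 1) H = twoPow (b + 1) b := fun j hj => by
    ext i hi
    rw [getElem_extractLsb', getElem_twoPow, Bool.eq_iff_iff,
      hH _ (by have := hend j hj; omega), decide_eq_true_eq]
    exact ⟨fun ⟨_, _, h⟩ => offset_unique hi (by omega) h, fun h => ⟨j, hj, by rw [h]⟩⟩
  have bL : ∀ j < n, extractLsb' (j * (b + 1)) (b + 1) L = 1#(b + 1) := fun j hj => by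
    ext i hi
    rw [getElem_extractLsb', Bool.eq_iff_iff, hL _ (by have := hend j hj; omega), getElem_one,
      decide_eq_true_eq]
    exact ⟨fun ⟨_, _, h⟩ => offset_unique hi (d := 0) (by omega) h,
      fun h => ⟨j, hj, by rw [h]; rfl⟩⟩
  have bz : ∀ j < n, extractLsb' (j * (b + 1)) (b + 1) z =
      if extractLsb' (j * (b + 1)) (b + 1) x < extractLsb' (j * (b + 1)) (b + 1) y
      then twoPow (b + 1) b else 0#(b + 1) := fun j hj => by
    rw [← compare_and_twoPow]
    simp only [z, extractLsb'_and, extractLsb'_or, extractLsb'_xor]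
    rw [extractLsb'_sub_of_le _ hj]
    · simp only [extractLsb'_and, extractLsb'_or, extractLsb'_not_of_le _ (hend j hj), bH j hj]
    · intro i hi
      simp only [extractLsb'_and, extractLsb'_or, extractLsb'_not_of_le _ (hend i hi), bH i hi]
      exact and_not_twoPow_le_or_twoPow _ _ _
  have bs : ∀ j < n, extractLsb' (j * (b + 1)) (b + 1) (z >>> b) =
      if extractLsb' (j * (b + 1)) (b + 1) x < extractLsb' (j * (b + 1)) (b + 1) y
      then 1#(b + 1) else 0#(b + 1) := fun j hj => by
    ext i hi
    rw [getElem_extractLsb', getLsbD_ushiftRight]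
    rcases i.eq_zero_or_pos with rfl | hi0
    · have h := congrArg (getLsbD · b) (bz j hj)
      simp only [getLsbD_extractLsb'] at h
      rw [Nat.add_zero (j * (b + 1)), Nat.add_comm b (j * (b + 1))]
      split_ifs at h ⊢ <;> simpa using h
    · have h : z.getLsbD (b + (j * (b + 1) + i)) = false := by
        rw [getLsbD_and]
        by_cases hp : b + (j * (b + 1) + i) < n * (b + 1)
        · have : H.getLsbD (b + (j * (b + 1) + i)) = false := by
            rw [Bool.eq_false_iff, Ne, hH _ hp]
            rintro ⟨l, -, h⟩
            have := offset_unique (i := j + 1) (c := i - 1) (j := l) (d := b) (by omega) (by omega)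
              (by rw [← h, Nat.succ_mul]; omega)
            omega
          simp [this]
        · simp [getLsbD_of_ge H _ (not_lt.1 hp)]
      rw [h]
      split_ifs
      · simp
        omega
      · simp
  intro j hj
  have bm : extractLsb' (j * (b + 1)) (b + 1) m =
      if extractLsb' (j * (b + 1)) (b + 1) x < extractLsb' (j * (b + 1)) (b + 1) y
      then 0#(b + 1) else allOnes (b + 1) := by
    rw [← mask_of_comparison]
    simp only [m, Nat.add_sub_cancel, extractLsb'_or, extractLsb'_xor]
    rw [extractLsb'_sub_of_le _ hj]
    · simp only [extractLsb'_or, bH j hj, bL j hj, bs j hj, bz j hj]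
    · intro i hi
      rw [extractLsb'_or, bH i hi, bL i hi]
      exact one_le_or_twoPow _ _
  rw [extractLsb'_or, extractLsb'_and, extractLsb'_and, extractLsb'_not_of_le _ (hend j hj), bm,
    toNat_select_max]
end
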